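/- Let V be a complex vector space with a Hermitian form ⟨·,·⟩ (linear in the first variable, conjugate-linear in the second, ⟨y,x⟩ = conj(⟨x,y⟩)). Let r₁, …, r₅ ∈ V satisfy ⟨rᵢ,rᵢ⟩ = 3 for all i, ⟨rᵢ,r_{i+1}⟩ = θ for i = 1, …, 4, and ⟨rᵢ,rⱼ⟩ = 0 whenever |i − j| ≥ 2. For each i let Rᵢ : V → V be the ω-reflection Rᵢ(x) = x − (1−ω)·(⟨x,rᵢ⟩/3)·rᵢ, and set ξ = r₁ − θr₂ − 2r₃ + θr₄ + r₅. Then ⟨ξ,ξ⟩ = 0, ⟨ξ,rᵢ⟩ = 0 for all i = 1, …, 5, ξ ≠ 0 whenever r₁, …, r₅ are linearly independent, and the sixth power of the composition R₁∘R₂∘R₃∘R₄∘R₅ equals the unitary transvection x ↦ x − (⟨x,ξ⟩/θ)·ξ on V. -/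

import Mathlib

noncomputable section

/-- The primitive cube root of unity `ω = e^{2πi/3}`. -/
def ω : ℂ := ⟨-1/2, Real.sqrt 3 / 2⟩

/-- `θ = ω - ω̄`, a square root of `-3`. -/
def θ : ℂ := ω - (starRingEnd ℂ) ω

theorem omega_sq_add_omega_add_one : ω ^ 2 + ω + 1 = 0 := by
  have h3 : Real.sqrt 3 * Real.sqrt 3 = 3 := Real.mul_self_sqrt (by norm_num)
  apply Complex.ext <;> simp [ω, pow_two] <;> linarith

theorem conj_omega : (starRingEnd ℂ) ω = -1 - ω := by
  apply Complex.ext <;> simp [ω]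
  norm_num

theorem theta_eq : θ = 1 + 2 * ω := by
  rw [θ, conj_omega]; ring

theorem conj_theta : (starRingEnd ℂ) θ = -θ := by
  simp [θ]

/-- The recurrence for the coordinates of the orbit of a vector under the product of the five
reflections; its sixth iterate, started at `0`, is a multiple of the coordinates of `ξ`. -/
theorem coxeter_recurrence_sixth {w : ℂ} (hw : w ^ 2 + w + 1 = 0) (b₀ b₁ b₂ b₃ b₄ : ℂ)
    (c₀ c₁ c₂ c₃ c₄ : ℕ → ℂ)
    (z₀ : c₀ 0 = 0) (z₁ : c₁ 0 = 0) (z₂ : c₂ 0 = 0) (z₃ : c₃ 0 = 0) (z₄ : c₄ 0 = 0)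
    (s₄ : ∀ n, c₄ (n + 1) = w * c₄ n - b₄ - (1 + w) * c₃ n)
    (s₃ : ∀ n, c₃ (n + 1) = w * c₃ n - b₃ - (1 + w) * c₂ n + (1 + w) * c₄ (n + 1))
    (s₂ : ∀ n, c₂ (n + 1) = w * c₂ n - b₂ - (1 + w) * c₁ n + (1 + w) * c₃ (n + 1))
    (s₁ : ∀ n, c₁ (n + 1) = w * c₁ n - b₁ - (1 + w) * c₀ n + (1 + w) * c₂ (n + 1))
    (s₀ : ∀ n, c₀ (n + 1) = w * c₀ n - b₀ + (1 + w) * c₁ (n + 1)) :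
    ∃ t, t = w * (b₀ + (1 + 2 * w) * b₁ - 2 * b₂ - (1 + 2 * w) * b₃ + b₄) ∧
      c₀ 6 = t ∧ c₁ 6 = -(1 + 2 * w) * t ∧ c₂ 6 = -2 * t ∧ c₃ 6 = (1 + 2 * w) * t ∧
      c₄ 6 = t := by
  refine ⟨_, rfl, ?_⟩
  have e41 : c₄ 1 = -b₄ := by
    rw [s₄ 0, z₄, z₃]
    ring
  have e31 : c₃ 1 = -b₃ + (-w - 1) * b₄ := by
    rw [s₃ 0, z₃, z₂, e41]
    ring
  have e21 : c₂ 1 = -b₂ + (-w - 1) * b₃ - w * b₄ := by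
    rw [s₂ 0, z₂, z₁, e31]
    linear_combination (-b₄) * hw
  have e11 : c₁ 1 = -b₁ + (-w - 1) * b₂ - w * b₃ + b₄ := by
    rw [s₁ 0, z₁, z₀, e21]
    linear_combination (-b₃ - b₄) * hw
  have e01 : c₀ 1 = -b₀ + (-w - 1) * b₁ - w * b₂ + b₃ + (w + 1) * b₄ := by
    rw [s₀ 0, z₀, e11]
    linear_combination (-b₂ - b₃) * hw
  have e42 : c₄ 2 = (w + 1) * b₃ - b₄ := by
    rw [s₄ 1, e41, e31]
    linear_combination b₄ * hw
  have e32 : c₃ 2 = (w + 1) * b₂ + (w - 1) * b₃ + (-w - 1) * b₄ := by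
    rw [s₃ 1, e31, e21, e42]
    linear_combination (2 * b₃) * hw
  have e22 : c₂ 2 = (w + 1) * b₁ + (w - 1) * b₂ + (-w - 2) * b₃ - w * b₄ := by
    rw [s₂ 1, e21, e11, e32]
    linear_combination (2 * b₂ + b₃ - 2 * b₄) * hw
  have e12 : c₁ 2 = (w + 1) * b₀ + (w - 1) * b₁ + (-w - 2) * b₂ + (-2 * w - 1) * b₃ + b₄ := by
    rw [s₁ 1, e11, e01, e22]
    linear_combination (2 * b₁ + b₂ - 2 * b₃ - 2 * b₄) * hw
  have e02 : c₀ 2 = -b₀ + (-w - 1) * b₁ - w * b₂ + b₃ + w * b₄ := by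
    rw [s₀ 1, e01, e12]
    linear_combination (b₀ - 2 * b₂ - 2 * b₃ + b₄) * hw
  have e43 : c₄ 3 = (-w) * b₂ + (w + 1) * b₃ - b₄ := by
    rw [s₄ 2, e42, e32]
    linear_combination (-b₂ + b₄) * hw
  have e33 : c₃ 3 = (-w) * b₁ + (w + 2) * b₂ + (w - 1) * b₃ + (-w - 1) * b₄ := by
    rw [s₃ 2, e32, e22, e43]
    linear_combination (-b₁ - b₂ + 3 * b₃) * hw
  have e23 : c₂ 3 = (-w) * b₀ + (w + 2) * b₁ + (2 * w) * b₂ + (-w - 2) * b₃ - w * b₄ := by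
    rw [s₂ 2, e22, e12, e33]
    linear_combination (-b₀ - b₁ + 3 * b₂ + 2 * b₃ - 2 * b₄) * hw
  have e13 : c₁ 3 = (w + 1) * b₀ + (w - 1) * b₁ + (-w - 2) * b₂ - 2 * w * b₃ + (w + 2) * b₄ := by
    rw [s₁ 2, e12, e02, e23]
    linear_combination (3 * b₁ + 2 * b₂ - 3 * b₃ - 2 * b₄) * hw
  have e03 : c₀ 3 = -b₀ + (-w - 1) * b₁ - w * b₂ + (w + 2) * b₃ + w * b₄ := by
    rw [s₀ 2, e02, e13]
    linear_combination (b₀ - 2 * b₂ - 2 * b₃ + 2 * b₄) * hw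
  have e44 : c₄ 4 = -b₁ - w * b₂ + (w + 1) * b₃ - b₄ := by
    rw [s₄ 3, e43, e33]
    linear_combination (b₁ - 2 * b₂ + b₄) * hw
  have e34 : c₃ 4 = -b₀ + (-2 * w - 1) * b₁ + (w + 2) * b₂ + (w - 1) * b₃ + (-w - 1) * b₄ := by
    rw [s₃ 3, e33, e23, e44]
    linear_combination (b₀ - 2 * b₁ - 2 * b₂ + 3 * b₃) * hw
  have e24 : c₂ 4 = (-w) * b₀ + (w + 2) * b₁ + (2 * w - 1) * b₂ + (-2 * w - 3) * b₃ - 2 * w * b₄ :=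
      by
    rw [s₂ 3, e23, e13, e34]
    linear_combination ((-2) * b₀ - 2 * b₁ + 4 * b₂ + 2 * b₃ - 3 * b₄) * hw
  have e14 : c₁ 4 = (w + 1) * b₀ + (w - 1) * b₁ + (-2 * w - 3) * b₂ - 3 * w * b₃ + (w + 2) * b₄ :=
      by
    rw [s₁ 3, e13, e03, e24]
    linear_combination (3 * b₁ + 2 * b₂ - 5 * b₃ - 2 * b₄) * hw
  have e04 : c₀ 4 = -b₀ + (-w - 1) * b₁ - 2 * w * b₂ + (w + 2) * b₃ + w * b₄ := by
    rw [s₀ 3, e03, e14]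
    linear_combination (b₀ - 3 * b₂ - 2 * b₃ + 2 * b₄) * hw
  have e45 : c₄ 5 = (w + 1) * b₀ - b₁ - w * b₂ + (w + 1) * b₃ - b₄ := by
    rw [s₄ 4, e44, e34]
    linear_combination (2 * b₁ - 2 * b₂ + b₄) * hw
  have e35 : c₃ 5 = -b₀ - 2 * w * b₁ + (2 * w + 3) * b₂ + (2 * w - 1) * b₃ + (-w - 2) * b₄ := by
    rw [s₃ 4, e34, e24, e45]
    linear_combination (2 * b₀ - 3 * b₁ - 2 * b₂ + 4 * b₃ + b₄) * hw
  have e25 : c₂ 5 = (-w) * b₀ + (2 * w + 3) * b₁ + (3 * w - 1) * b₂ + (-2 * w - 4) * b₃ - 2 * w *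
      b₄ := by
    rw [s₂ 4, e24, e14, e35]
    linear_combination ((-2) * b₀ - 2 * b₁ + 6 * b₂ + 3 * b₃ - 4 * b₄) * hw
  have e15 : c₁ 5 = (w + 1) * b₀ + (2 * w - 1) * b₁ + (-2 * w - 4) * b₂ - 3 * w * b₃ + (w + 2) *
      b₄ := by
    rw [s₁ 4, e14, e04, e25]
    linear_combination (4 * b₁ + 3 * b₂ - 6 * b₃ - 2 * b₄) * hw
  have e05 : c₀ 5 = -b₀ + (-w - 2) * b₁ - 2 * w * b₂ + (w + 2) * b₃ + w * b₄ := by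
    rw [s₀ 4, e04, e15]
    linear_combination (b₀ + b₁ - 4 * b₂ - 2 * b₃ + 2 * b₄) * hw
  have e46 : c₄ 6 = w * b₀ + (-w - 2) * b₁ - 2 * w * b₂ + (w + 2) * b₃ + w * b₄ := by
    rw [s₄ 5, e45, e35]
    linear_combination (b₀ + 2 * b₁ - 3 * b₂ - b₃ + b₄) * hw
  have e36 : c₃ 6 = (-w - 2) * b₀ - 3 * w * b₁ + (2 * w + 4) * b₂ + (3 * w) * b₃ + (-w - 2) * b₄ :=
      by
    rw [s₃ 5, e35, e25, e46]
    linear_combination (2 * b₀ - 5 * b₁ - 3 * b₂ + 5 * b₃ + 2 * b₄) * hw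
  have e26 : c₂ 6 = (-2 * w) * b₀ + (2 * w + 4) * b₁ + (4 * w) * b₂ + (-2 * w - 4) * b₃ - 2 * w *
      b₄ := by
    rw [s₂ 5, e25, e15, e36]
    linear_combination ((-3) * b₀ - 3 * b₁ + 7 * b₂ + 4 * b₃ - 4 * b₄) * hw
  have e16 : c₁ 6 = (w + 2) * b₀ + (3 * w) * b₁ + (-2 * w - 4) * b₂ - 3 * w * b₃ + (w + 2) * b₄ :=
      by
    rw [s₁ 5, e15, e05, e26]
    linear_combination (-b₀ + 5 * b₁ + 4 * b₂ - 6 * b₃ - 2 * b₄) * hw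
  have e06 : c₀ 6 = w * b₀ + (-w - 2) * b₁ - 2 * w * b₂ + (w + 2) * b₃ + w * b₄ := by
    rw [s₀ 5, e05, e16]
    linear_combination (b₀ + 2 * b₁ - 4 * b₂ - 2 * b₃ + 2 * b₄) * hw
  refine ⟨?_, ?_, ?_, ?_, ?_⟩
  · linear_combination e06 + ((-2) * b₁ + 2 * b₃) * hw
  · linear_combination e16 + (2 * b₀ + (4 * w) * b₁ - 4 * b₂ - 4 * w * b₃ + 2 * b₄) * hw
  · linear_combination e26 + (4 * b₁ - 4 * b₃) * hw
  · linear_combination e36 + ((-2) * b₀ - 4 * w * b₁ + 4 * b₂ + (4 * w) * b₃ - 2 * b₄) * hw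
  · linear_combination e46 + ((-2) * b₁ + 2 * b₃) * hw

set_option maxHeartbeats 800000 in
/-- Given vectors `r₁,…,r₅` of norm 3 in a complex Hermitian space with
`⟨rᵢ,r_{i+1}⟩ = θ` and all other inner products zero, and `ξ = r₁ − θr₂ − 2r₃ + θr₄ + r₅`,
one has `⟨ξ,ξ⟩ = 0`, `⟨ξ,rᵢ⟩ = 0` for all `i`, `ξ ≠ 0` if the `rᵢ` are linearly
independent, and the sixth power of the product of the `ω`-reflections `R₁∘⋯∘R₅` is the
unitary transvection `x ↦ x − (⟨x,ξ⟩/θ)ξ`. -/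
theorem stmt_16 (V : Type*) [AddCommGroup V] [Module ℂ V]
    (h : V → V → ℂ)
    (haddl : ∀ x x' y : V, h (x + x') y = h x y + h x' y)
    (haddr : ∀ x y y' : V, h x (y + y') = h x y + h x y')
    (hsmul : ∀ (c : ℂ) (x y : V), h (c • x) y = c * h x y)
    (hconj : ∀ x y : V, h y x = (starRingEnd ℂ) (h x y))
    (r : Fin 5 → V)
    (hnorm : ∀ i, h (r i) (r i) = 3)
    (hadj : ∀ (i : Fin 5) (hi : i.val + 1 < 5), h (r i) (r ⟨i.val + 1, hi⟩) = θ)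
    (hfar : ∀ i j : Fin 5, (i.val + 2 ≤ j.val ∨ j.val + 2 ≤ i.val) → h (r i) (r j) = 0)
    (R : Fin 5 → V → V)
    (hR : ∀ i x, R i x = x - ((1 - ω) * h x (r i) / 3) • r i)
    (ξ : V)
    (hξdef : ξ = r 0 - θ • r 1 - (2 : ℂ) • r 2 + θ • r 3 + r 4) :
    h ξ ξ = 0 ∧
    (∀ i, h ξ (r i) = 0) ∧
    (LinearIndependent ℂ r → ξ ≠ 0) ∧
    (∀ x : V, (R 0 ∘ R 1 ∘ R 2 ∘ R 3 ∘ R 4)^[6] x = x - (h x ξ / θ) • ξ) := by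
  have hw := omega_sq_add_omega_add_one
  have hθ := theta_eq
  have hθ0 : θ ≠ 0 := by
    intro h0; grind
  have hsmulr (c : ℂ) (x y : V) : h x (c • y) = (starRingEnd ℂ) c * h x y := by
    rw [hconj, hsmul, map_mul, ← hconj]
  have hnegl (x y : V) : h (-x) y = -h x y := by
    simpa using hsmul (-1) x y
  have hnegr (x y : V) : h x (-y) = -h x y := by
    simpa using hsmulr (-1) x y
  have hadj' (i : Fin 5) (hi : i.val + 1 < 5) : h (r ⟨i.val + 1, hi⟩) (r i) = -θ := by
    rw [hconj, hadj i hi, conj_theta]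
  have g01 : h (r 0) (r 1) = θ := hadj 0 (by decide)
  have g12 : h (r 1) (r 2) = θ := hadj 1 (by decide)
  have g23 : h (r 2) (r 3) = θ := hadj 2 (by decide)
  have g34 : h (r 3) (r 4) = θ := hadj 3 (by decide)
  have g10 : h (r 1) (r 0) = -θ := hadj' 0 (by decide)
  have g21 : h (r 2) (r 1) = -θ := hadj' 1 (by decide)
  have g32 : h (r 3) (r 2) = -θ := hadj' 2 (by decide)
  have g43 : h (r 4) (r 3) = -θ := hadj' 3 (by decide)
  have g02 : h (r 0) (r 2) = 0 := hfar 0 2 (by decide)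
  have g03 : h (r 0) (r 3) = 0 := hfar 0 3 (by decide)
  have g04 : h (r 0) (r 4) = 0 := hfar 0 4 (by decide)
  have g13 : h (r 1) (r 3) = 0 := hfar 1 3 (by decide)
  have g14 : h (r 1) (r 4) = 0 := hfar 1 4 (by decide)
  have g20 : h (r 2) (r 0) = 0 := hfar 2 0 (by decide)
  have g24 : h (r 2) (r 4) = 0 := hfar 2 4 (by decide)
  have g30 : h (r 3) (r 0) = 0 := hfar 3 0 (by decide)
  have g31 : h (r 3) (r 1) = 0 := hfar 3 1 (by decide)
  have g40 : h (r 4) (r 0) = 0 := hfar 4 0 (by decide)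
  have g41 : h (r 4) (r 1) = 0 := hfar 4 1 (by decide)
  have g42 : h (r 4) (r 2) = 0 := hfar 4 2 (by decide)
  have hξr (i : Fin 5) : h ξ (r i) = 0 := by
    subst hξdef
    fin_cases i <;>
      simp [sub_eq_add_neg, haddl, hnegl, hsmul, hnorm, g01, g02, g03, g04, g10, g12, g13, g14,
          g20, g21, g23, g24, g30, g31, g32, g34, g40, g41, g42, g43] <;>
      grind
  have hxξ (x : V) : h x ξ =
      h x (r 0) + θ * h x (r 1) - 2 * h x (r 2) - θ * h x (r 3) + h x (r 4) := by
    rw [hξdef]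
    simp [sub_eq_add_neg, haddr, hnegr, hsmulr, conj_theta,
      show (starRingEnd ℂ) 2 = 2 from map_ofNat _ 2]
  refine ⟨by simp [hxξ, hξr], hξr, ?_, fun x => ?_⟩
  · rintro hli rfl
    have := Fintype.linearIndependent_iff.1 hli ![1, -θ, -2, θ, 1]
      (by rw [hξdef]; simp [Fin.sum_univ_five]; module) 0
    simp at this
  · let b (i : Fin 5) : ℂ := (1 - ω) * h x (r i) / 3
    let v (c : Fin 5 → ℂ) : V := x + (c 0 • r 0 + c 1 • r 1 + c 2 • r 2 + c 3 • r 3 + c 4 • r 4)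
    let f (c : Fin 5 → ℂ) : Fin 5 → ℂ :=
      let d₄ := ω * c 4 - b 4 - (1 + ω) * c 3
      let d₃ := ω * c 3 - b 3 - (1 + ω) * c 2 + (1 + ω) * d₄
      let d₂ := ω * c 2 - b 2 - (1 + ω) * c 1 + (1 + ω) * d₃
      let d₁ := ω * c 1 - b 1 - (1 + ω) * c 0 + (1 + ω) * d₂
      let d₀ := ω * c 0 - b 0 + (1 + ω) * d₁
      ![d₀, d₁, d₂, d₃, d₄]
    have R0 (c : Fin 5 → ℂ) : R 0 (v c) =
        v ![ω * c 0 - b 0 + (1 + ω) * c 1, c 1, c 2, c 3, c 4] := by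
      rw [hR]
      simp only [v, b, haddl, hsmul, hnorm, g10, g20, g30, g40]
      simp
      match_scalars <;> grind
    have R1 (c : Fin 5 → ℂ) : R 1 (v c) =
        v ![c 0, ω * c 1 - b 1 - (1 + ω) * c 0 + (1 + ω) * c 2, c 2, c 3, c 4] := by
      rw [hR]
      simp only [v, b, haddl, hsmul, hnorm, g01, g21, g31, g41]
      simp
      match_scalars <;> grind
    have R2 (c : Fin 5 → ℂ) : R 2 (v c) =
        v ![c 0, c 1, ω * c 2 - b 2 - (1 + ω) * c 1 + (1 + ω) * c 3, c 3, c 4] := by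
      rw [hR]
      simp only [v, b, haddl, hsmul, hnorm, g02, g12, g32, g42]
      simp
      match_scalars <;> grind
    have R3 (c : Fin 5 → ℂ) : R 3 (v c) =
        v ![c 0, c 1, c 2, ω * c 3 - b 3 - (1 + ω) * c 2 + (1 + ω) * c 4, c 4] := by
      rw [hR]
      simp only [v, b, haddl, hsmul, hnorm, g03, g13, g23, g43]
      simp
      match_scalars <;> grind
    have R4 (c : Fin 5 → ℂ) : R 4 (v c) =
        v ![c 0, c 1, c 2, c 3, ω * c 4 - b 4 - (1 + ω) * c 3] := by
      rw [hR]
      simp only [v, b, haddl, hsmul, hnorm, g04, g14, g24, g34]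
      simp
      match_scalars <;> grind
    have f₄ (c) : f c 4 = ω * c 4 - b 4 - (1 + ω) * c 3 := rfl
    have f₃ (c) : f c 3 = ω * c 3 - b 3 - (1 + ω) * c 2 + (1 + ω) * f c 4 := rfl
    have f₂ (c) : f c 2 = ω * c 2 - b 2 - (1 + ω) * c 1 + (1 + ω) * f c 3 := rfl
    have f₁ (c) : f c 1 = ω * c 1 - b 1 - (1 + ω) * c 0 + (1 + ω) * f c 2 := rfl
    have f₀ (c) : f c 0 = ω * c 0 - b 0 + (1 + ω) * f c 1 := rfl
    have hstep (c : Fin 5 → ℂ) : (R 0 ∘ R 1 ∘ R 2 ∘ R 3 ∘ R 4) (v c) = v (f c) := by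
      simp only [Function.comp_apply, R0, R1, R2, R3, R4]
      simp [f]
    have hiter (n : ℕ) : (R 0 ∘ R 1 ∘ R 2 ∘ R 3 ∘ R 4)^[n] (v 0) = v (f^[n] 0) :=
      (Function.Semiconj.iterate_right (f := v) (fun c => (hstep c).symm) n 0).symm
    have hv0 : v 0 = x := by simp [v]
    have hsucc (n : ℕ) : f^[n + 1] 0 = f (f^[n] 0) := Function.iterate_succ_apply' f n 0
    clear_value f
    obtain ⟨t, ht, h₀, h₁, h₂, h₃, h₄⟩ := coxeter_recurrence_sixth hw (b 0) (b 1) (b 2) (b 3) (b 4)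
      (fun n => f^[n] 0 0) (fun n => f^[n] 0 1) (fun n => f^[n] 0 2) (fun n => f^[n] 0 3)
      (fun n => f^[n] 0 4) rfl rfl rfl rfl rfl
      (fun n => by simp only [hsucc, f₄]) (fun n => by simp only [hsucc, f₃])
      (fun n => by simp only [hsucc, f₂]) (fun n => by simp only [hsucc, f₁])
      (fun n => by simp only [hsucc, f₀])
    have ht' : h x ξ / θ = -t := by
      rw [div_eq_iff hθ0, ht, hxξ, hθ]
      simp only [b]
      linear_combination (3 - 2 * ω) / 3 * (h x (r 0) + (1 + 2 * ω) * h x (r 1) - 2 * h x (r 2) -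
        (1 + 2 * ω) * h x (r 3) + h x (r 4)) * hw
    have h6 := hiter 6
    rw [hv0] at h6
    rw [h6, ht', hξdef]
    simp only [v, h₀, h₁, h₂, h₃, h₄, hθ]
    module
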